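/- arXiv:2011.06394 — 2 statements merged into one kernel-verified Lean document; each statement's English description precedes it below -/
import Mathlib

section
/- Assume 0 < k a₁ < c. There exist Pr₀ > 0 and functions X⁻, X⁺ : (Pr₀, ∞) → ℂ such that P_Pr(X⁻(Pr)) = 0 and P_Pr(X⁺(Pr)) = 0 for all Pr > Pr₀, and as Pr → ∞ one has the asymptotic expansions X^∓(Pr) = −i k a₁ ∓ c(k) ∓ (3(γ−1) k a₁ (k a₁ ± i c(k)) / (4 c(k))) · Pr⁻¹ + O(Pr⁻²) (meaning: the difference between X^∓(Pr) and the displayed two-term expansion is O(Pr⁻²) as Pr → ∞). -/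
open Complex Filter Asymptotics

/-- The dispersion-relation cubic P_Pr. -/
noncomputable def P (k a₁ c γ Pr : ℝ) (X : ℂ) : ℂ :=
  X ^ 3 + 2 * I * (k : ℂ) * (a₁ : ℂ) * (1 + 3 * (γ : ℂ) / (4 * (Pr : ℂ))) * X ^ 2
    - ((c : ℂ) ^ 2 + (3 * (γ : ℂ) / (Pr : ℂ)) * (a₁ : ℂ) ^ 2 * (k : ℂ) ^ 2) * X
    - (3 * I * (k : ℂ) * (a₁ : ℂ) * (c : ℂ) ^ 2) / (2 * (Pr : ℂ))

/-- Any point `y` is within `3 ‖p y‖ / ‖p' y‖` of a root of the monic complex cubic `p`. -/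
theorem exists_cubic_root_norm_sub_mul_norm_deriv_le (a b d y : ℂ) :
    ∃ r : ℂ, r ^ 3 + a * r ^ 2 + b * r + d = 0 ∧
      ‖r - y‖ * ‖3 * y ^ 2 + 2 * a * y + b‖ ≤ 3 * ‖y ^ 3 + a * y ^ 2 + b * y + d‖ := by
  obtain ⟨u, v, w, h⟩ := (Cubic.splits_iff_roots_eq_three (P := ⟨1, a, b, d⟩)
    (φ := RingHom.id ℂ) one_ne_zero).1 (IsAlgClosed.splits _)
  have ha := Cubic.b_eq_three_roots (P := ⟨1, a, b, d⟩) (φ := RingHom.id ℂ) one_ne_zero h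
  have hb := Cubic.c_eq_three_roots (P := ⟨1, a, b, d⟩) (φ := RingHom.id ℂ) one_ne_zero h
  have hd := Cubic.d_eq_three_roots (P := ⟨1, a, b, d⟩) (φ := RingHom.id ℂ) one_ne_zero h
  simp only [RingHom.id_apply, one_mul] at ha hb hd
  have key : ∀ r s t : ℂ, a = -(r + s + t) → b = r * s + r * t + s * t → d = -(r * s * t) →
      ‖r - y‖ ≤ ‖s - y‖ → ‖r - y‖ ≤ ‖t - y‖ →
      ∃ r : ℂ, r ^ 3 + a * r ^ 2 + b * r + d = 0 ∧
        ‖r - y‖ * ‖3 * y ^ 2 + 2 * a * y + b‖ ≤ 3 * ‖y ^ 3 + a * y ^ 2 + b * y + d‖ := by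
    intro r s t ha hb hd hs ht
    refine ⟨r, by rw [ha, hb, hd]; ring, ?_⟩
    have hp : y ^ 3 + a * y ^ 2 + b * y + d = -((r - y) * (s - y) * (t - y)) := by
      rw [ha, hb, hd]; ring
    have hp' : 3 * y ^ 2 + 2 * a * y + b =
        (s - y) * (t - y) + (r - y) * (t - y) + (r - y) * (s - y) := by
      rw [ha, hb]; ring
    have hle := norm_add₃_le (a := (s - y) * (t - y)) (b := (r - y) * (t - y))
      (c := (r - y) * (s - y))
    rw [hp, hp', norm_neg]
    simp only [norm_mul] at hle ⊢
    have h₁ : ‖r - y‖ * ‖t - y‖ ≤ ‖s - y‖ * ‖t - y‖ := by gcongr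
    have h₂ : ‖r - y‖ * ‖s - y‖ ≤ ‖t - y‖ * ‖s - y‖ := by gcongr
    calc _ ≤ ‖r - y‖ * (3 * (‖s - y‖ * ‖t - y‖)) := by gcongr; linarith
      _ = _ := by ring
  rcases le_total ‖u - y‖ ‖v - y‖ with huv | huv
  · rcases le_total ‖u - y‖ ‖w - y‖ with huw | huw
    · exact key u v w ha hb hd huv huw
    · exact key w u v (by rw [ha]; ring) (by rw [hb]; ring) (by rw [hd]; ring) huw
        (huw.trans huv)
  · rcases le_total ‖v - y‖ ‖w - y‖ with hvw | hvw
    · exact key v u w (by rw [ha]; ring) (by rw [hb]; ring) (by rw [hd]; ring) huv hvw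
    · exact key w u v (by rw [ha]; ring) (by rw [hb]; ring) (by rw [hd]; ring)
        (hvw.trans huv) hvw

/-- First-order perturbation of a simple root `x₀` of a monic complex cubic whose coefficients
depend affinely on `e`. -/
theorem exists_cubic_root_isBigO (a₀ a₁ b₀ b₁ d₀ d₁ x₀ x₁ : ℂ)
    (h₀ : x₀ ^ 3 + a₀ * x₀ ^ 2 + b₀ * x₀ + d₀ = 0)
    (h₁ : (3 * x₀ ^ 2 + 2 * a₀ * x₀ + b₀) * x₁ + (a₁ * x₀ ^ 2 + b₁ * x₀ + d₁) = 0)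
    (hne : 3 * x₀ ^ 2 + 2 * a₀ * x₀ + b₀ ≠ 0) :
    ∃ X : ℂ → ℂ,
      (∀ e, X e ^ 3 + (a₀ + e * a₁) * X e ^ 2 + (b₀ + e * b₁) * X e + (d₀ + e * d₁) = 0) ∧
      (fun e => X e - (x₀ + e * x₁)) =O[nhds 0] fun e => e ^ 2 := by
  choose X hX hle using fun e : ℂ => exists_cubic_root_norm_sub_mul_norm_deriv_le
    (a₀ + e * a₁) (b₀ + e * b₁) (d₀ + e * d₁) (x₀ + e * x₁)
  refine ⟨X, hX, ?_⟩
  let p' : ℂ → ℂ := fun e =>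
    3 * (x₀ + e * x₁) ^ 2 + 2 * (a₀ + e * a₁) * (x₀ + e * x₁) + (b₀ + e * b₁)
  let q : ℂ → ℂ := fun e =>
    (3 * x₀ + a₀) * x₁ ^ 2 + e * x₁ ^ 3 + (2 * a₁ * x₀ + b₁) * x₁ + e * a₁ * x₁ ^ 2
  have hp' : ContinuousAt p' 0 := by fun_prop
  have hq : ContinuousAt q 0 := by fun_prop
  have hp'0 : p' 0 ≠ 0 := by simpa [p'] using hne
  have hpq : ∀ e, (x₀ + e * x₁) ^ 3 + (a₀ + e * a₁) * (x₀ + e * x₁) ^ 2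
      + (b₀ + e * b₁) * (x₀ + e * x₁) + (d₀ + e * d₁) = e ^ 2 * q e := by
    intro e
    linear_combination h₀ + e * h₁
  have hmul : (fun e => X e - (x₀ + e * x₁)) =O[nhds 0] fun e => e ^ 2 * (q e * (p' e)⁻¹) := by
    refine IsBigO.of_bound 3 ?_
    filter_upwards [hp'.eventually_ne hp'0] with e he
    have := hle e
    rw [hpq e] at this
    rw [← mul_assoc, norm_mul _ (p' e)⁻¹, norm_inv, ← mul_assoc, ← div_eq_mul_inv,
      le_div_iff₀ (norm_pos_iff.2 he)]
    exact this
  have hbdd : (fun e => q e * (p' e)⁻¹) =O[nhds 0] fun _ => (1 : ℂ) :=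
    (hq.mul (hp'.inv₀ hp'0)).tendsto.isBigO_one ℂ
  simpa using hmul.trans ((isBigO_refl (fun e : ℂ => e ^ 2) (nhds 0)).mul hbdd)

/-- Expansion of the root of `P` near a simple nonzero root `x₀ = -i k a₁ + σ` of the limiting
cubic. -/
theorem exists_P_root_isBigO (k a₁ c γ : ℝ) (σ x₁ : ℂ)
    (hσ : σ ^ 2 = (c : ℂ) ^ 2 - (k : ℂ) ^ 2 * (a₁ : ℂ) ^ 2) (hσ0 : σ ≠ 0) (hc : c ≠ 0)
    (hx₁ : x₁ = 3 * ((γ : ℂ) - 1) * k * a₁ * (k * a₁ - I * σ) / (4 * σ)) :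
    ∃ X : ℝ → ℂ, (∀ Pr, P k a₁ c γ Pr (X Pr) = 0) ∧
      (fun Pr : ℝ => X Pr - (-(I * k * a₁) + σ + x₁ / (Pr : ℂ)))
        =O[atTop] fun Pr : ℝ => (Pr ^ 2)⁻¹ := by
  have hx₀ : (-(I * k * a₁) + σ) * (I * k * a₁ + σ) = (c : ℂ) ^ 2 := by
    linear_combination hσ - (k : ℂ) ^ 2 * a₁ ^ 2 * I_sq
  have hx₀0 : -(I * k * a₁) + σ ≠ 0 := by
    intro h
    rw [h, zero_mul] at hx₀
    exact hc (by simpa using hx₀.symm)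
  have hderiv : 3 * (-(I * k * a₁) + σ) ^ 2 + 2 * (2 * I * k * a₁) * (-(I * k * a₁) + σ)
      + -(c : ℂ) ^ 2 = 2 * σ * (-(I * k * a₁) + σ) := by
    linear_combination hx₀
  obtain ⟨X, hX, hO⟩ := exists_cubic_root_isBigO (2 * I * k * a₁) (3 / 2 * γ * I * k * a₁)
    (-(c : ℂ) ^ 2) (-(3 * γ * a₁ ^ 2 * k ^ 2)) 0 (-(3 / 2 * I * k * a₁ * c ^ 2))
    (-(I * k * a₁) + σ) x₁ (by linear_combination (-(I * k * a₁) + σ) * hx₀)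
    (by
      have h4 : 4 * σ * x₁ = 3 * ((γ : ℂ) - 1) * k * a₁ * (k * a₁ - I * σ) := by
        rw [hx₁]; field_simp
      rw [hderiv]
      linear_combination (-(I * k * a₁) + σ) / 2 * h4 + 3 / 2 * I * k * a₁ * hx₀
        + (k : ℂ) ^ 2 * a₁ ^ 2 * (-(I * k * a₁) + σ) * (3 / 2 * (γ - 1) - 3 * γ) * I_sq)
    (by rw [hderiv]; exact mul_ne_zero (mul_ne_zero two_ne_zero hσ0) hx₀0)
  have hlim : Tendsto (fun Pr : ℝ => (Pr : ℂ)⁻¹) atTop (nhds 0) := by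
    simpa [Function.comp_def] using (continuous_ofReal.tendsto 0).comp tendsto_inv_atTop_zero
  refine ⟨fun Pr => X (Pr : ℂ)⁻¹, fun Pr => ?_, ?_⟩
  · rw [← hX (Pr : ℂ)⁻¹, P]
    simp only [div_eq_mul_inv, mul_inv]
    ring
  · refine ((hO.comp_tendsto hlim).congr_left fun Pr => ?_).trans (IsBigO.of_bound 1 ?_)
    · simp only [Function.comp_apply, div_eq_mul_inv]
      ring
    · exact Eventually.of_forall fun Pr => by simp

/-- Assume 0 < k a₁ < c. There exist Pr₀ > 0 and functions
X⁻, X⁺ : (Pr₀, ∞) → ℂ that are roots of P_Pr with the asymptotic expansions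
X^∓(Pr) = −i k a₁ ∓ c(k) ∓ (3(γ−1) k a₁ (k a₁ ± i c(k)) / (4 c(k))) · Pr⁻¹ + O(Pr⁻²)
as Pr → ∞. -/
theorem stmt_3 (ρ μ c k γ : ℝ) (hρ : 0 < ρ) (hμ : 0 < μ) (hc : 0 < c) (hk : 0 < k)
    (hγ : 1 < γ) (a₁ : ℝ) (ha₁ : a₁ = 2 * μ / (3 * ρ))
    (hka : 0 < k * a₁) (hlt : k * a₁ < c)
    (ck : ℝ) (hck : ck = Real.sqrt (c ^ 2 - k ^ 2 * a₁ ^ 2)) :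
    ∃ Pr₀ : ℝ, 0 < Pr₀ ∧ ∃ Xm Xp : ℝ → ℂ,
      (∀ Pr : ℝ, Pr₀ < Pr → P k a₁ c γ Pr (Xm Pr) = 0 ∧ P k a₁ c γ Pr (Xp Pr) = 0)
      ∧ (fun Pr : ℝ => Xm Pr -
            (-(I * (k : ℂ) * (a₁ : ℂ)) - (ck : ℂ)
              - (3 * ((γ : ℂ) - 1) * (k : ℂ) * (a₁ : ℂ)
                  * ((k : ℂ) * (a₁ : ℂ) + I * (ck : ℂ)) / (4 * (ck : ℂ))) / (Pr : ℂ)))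
          =O[atTop] (fun Pr : ℝ => (Pr ^ 2)⁻¹)
      ∧ (fun Pr : ℝ => Xp Pr -
            (-(I * (k : ℂ) * (a₁ : ℂ)) + (ck : ℂ)
              + (3 * ((γ : ℂ) - 1) * (k : ℂ) * (a₁ : ℂ)
                  * ((k : ℂ) * (a₁ : ℂ) - I * (ck : ℂ)) / (4 * (ck : ℂ))) / (Pr : ℂ)))
          =O[atTop] (fun Pr : ℝ => (Pr ^ 2)⁻¹) := by
  have hpos : 0 < c ^ 2 - k ^ 2 * a₁ ^ 2 := by nlinarith
  have hck0 : (ck : ℂ) ≠ 0 := by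
    rw [hck]
    exact ofReal_ne_zero.2 (Real.sqrt_pos.2 hpos).ne'
  have hsq : (ck : ℂ) ^ 2 = (c : ℂ) ^ 2 - (k : ℂ) ^ 2 * (a₁ : ℂ) ^ 2 := by
    have : ck ^ 2 = c ^ 2 - k ^ 2 * a₁ ^ 2 := by rw [hck, Real.sq_sqrt hpos.le]
    exact_mod_cast this
  obtain ⟨Xm, hXm, hOm⟩ := exists_P_root_isBigO k a₁ c γ (-ck)
    (-(3 * ((γ : ℂ) - 1) * k * a₁ * (k * a₁ + I * ck) / (4 * ck)))
    (by rw [neg_sq, hsq]) (neg_ne_zero.2 hck0) hc.ne' (by field_simp; ring)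
  obtain ⟨Xp, hXp, hOp⟩ := exists_P_root_isBigO k a₁ c γ ck _ hsq hck0 hc.ne' rfl
  refine ⟨1, one_pos, Xm, Xp, fun Pr _ => ⟨hXm Pr, hXp Pr⟩, ?_, hOp⟩
  exact hOm.congr_left fun Pr => by ring
end

section
/- Assume 0 < k a₁ < c/√γ. There exist ε > 0 and functions ξ⁻, ξ⁰, ξ⁺ : (0, ε) → ℂ such that for every Pr ∈ (0, ε) the values ξ⁻(Pr), ξ⁰(Pr), ξ⁺(Pr) are roots of P_Pr, and as Pr → 0⁺ one has the expansions ξ^∓(Pr) = −i k a₁ ∓ c_T(k) ± ((γ−1) c² (k a₁ ∓ i c_T(k)) / (3 γ² k a₁ c_T(k))) · Pr + O(Pr²) and ξ⁰(Pr) = −(3 i k a₁ γ)/(2 Pr) + O(Pr). -/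
open Complex Filter Asymptotics

open Polynomial in
/-- A complex polynomial has a root within `deg p * |p z| / |p' z|` of any point `z`. -/
theorem exists_isRoot_norm_sub_mul_le {p : ℂ[X]} (hp : p.degree ≠ 0) (z : ℂ) :
    ∃ r, p.IsRoot r ∧ ‖z - r‖ * ‖p.derivative.eval z‖ ≤ p.natDegree * ‖p.eval z‖ := by
  by_cases hz : p.eval z = 0
  · exact ⟨z, hz, by simp [hz]⟩
  have hp0 : p ≠ 0 := by rintro rfl; simp at hz
  have hs : p.Splits := IsAlgClosed.splits p
  by_contra! h
  have hd : 0 < p.natDegree := by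
    rw [Nat.pos_iff_ne_zero]
    intro h0
    exact hp (by rw [Polynomial.degree_eq_natDegree hp0, h0]; rfl)
  have hdn : (0 : ℝ) < p.natDegree := by exact_mod_cast hd
  have hz' : 0 < ‖p.eval z‖ := norm_pos_iff.2 hz
  have key := hs.eval_derivative_div_eval_of_ne_zero hz
  have hcard : p.roots.card = p.natDegree := hs.natDegree_eq_card_roots.symm
  have hroot : ∀ r ∈ p.roots, ‖1 / (z - r)‖ <
      ‖p.derivative.eval z / p.eval z‖ / p.natDegree := by
    intro r hr
    have h1 := h r (Polynomial.isRoot_of_mem_roots hr)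
    have hzr : 0 < ‖z - r‖ := by
      rw [norm_pos_iff, sub_ne_zero]
      rintro rfl
      exact hz (Polynomial.isRoot_of_mem_roots hr)
    rw [norm_div, norm_div, norm_one, div_div, div_lt_div_iff₀ hzr (by positivity)]
    linarith
  have hne : p.roots ≠ 0 := by
    rw [← Multiset.card_pos, hcard]; exact hd
  have hsum : (p.roots.map fun r => ‖1 / (z - r)‖).sum <
      (p.roots.map fun _ => ‖p.derivative.eval z / p.eval z‖ / p.natDegree).sum :=
    Multiset.sum_lt_sum_of_nonempty hne hroot
  rw [Multiset.map_const', Multiset.sum_replicate, hcard, nsmul_eq_mul,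
    mul_div_cancel₀ _ hdn.ne', key] at hsum
  have htri := norm_multiset_sum_le (p.roots.map fun r => 1 / (z - r))
  rw [Multiset.map_map] at htri
  exact absurd (htri.trans_lt hsum) (lt_irrefl _)

/-- A monic complex cubic has a root within `3 |f z| / |f' z|` of any point `z`. -/
theorem exists_cubic_root_norm_sub_mul_le (a b d z : ℂ) :
    ∃ r : ℂ, r ^ 3 + a * r ^ 2 + b * r + d = 0 ∧
      ‖z - r‖ * ‖3 * z ^ 2 + 2 * a * z + b‖ ≤ 3 * ‖z ^ 3 + a * z ^ 2 + b * z + d‖ := by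
  have hdeg : (Cubic.mk 1 a b d).toPoly.natDegree = 3 :=
    Cubic.natDegree_of_a_ne_zero one_ne_zero
  have hdeg' : (Cubic.mk 1 a b d).toPoly.degree ≠ 0 := by
    rw [Cubic.degree_of_a_ne_zero one_ne_zero]; decide
  obtain ⟨r, hr, hle⟩ := exists_isRoot_norm_sub_mul_le hdeg' z
  refine ⟨r, ?_, ?_⟩
  · simpa [Cubic.toPoly, Polynomial.IsRoot] using hr
  · rw [hdeg] at hle
    have hder : (Cubic.mk 1 a b d).toPoly.derivative.eval z = 3 * z ^ 2 + 2 * a * z + b := by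
      simp [Cubic.toPoly]
      ring
    have hval : (Cubic.mk 1 a b d).toPoly.eval z = z ^ 3 + a * z ^ 2 + b * z + d := by
      simp [Cubic.toPoly]
    rwa [hder, hval] at hle

/-- The third root of a monic cubic, given two distinct roots. -/
theorem cubic_eq_zero_of_two_roots {K : Type*} [Field K] {a b d x y : K} (hxy : x ≠ y)
    (hx : x ^ 3 + a * x ^ 2 + b * x + d = 0) (hy : y ^ 3 + a * y ^ 2 + b * y + d = 0) :
    (-a - x - y) ^ 3 + a * (-a - x - y) ^ 2 + b * (-a - x - y) + d = 0 := by
  apply mul_left_cancel₀ (sub_ne_zero.2 hxy)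
  linear_combination (-a - x - y - y) * hx - (-a - x - y - x) * hy

theorem isBigO_sub_const_of_expansion {f : ℝ → ℂ} {z w : ℂ}
    (h : (fun p : ℝ => f p - (z - w * p)) =O[nhdsWithin 0 (Set.Ioi 0)] (fun p : ℝ => p ^ 2)) :
    (fun p : ℝ => f p - z) =O[nhdsWithin 0 (Set.Ioi 0)] (fun p : ℝ => p) := by
  have hlin : (fun p : ℝ => w * p) =O[nhdsWithin 0 (Set.Ioi 0)] (fun p : ℝ => p) :=
    IsBigO.of_bound ‖w‖ (by simp)
  have hpow : (fun p : ℝ => p ^ 2) =O[nhdsWithin 0 (Set.Ioi 0)] (fun p : ℝ => p) :=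
    (isLittleO_pow_id one_lt_two).isBigO.mono nhdsWithin_le_nhds
  exact ((h.trans hpow).sub hlin).congr_left fun p => by ring

theorem P_eq (k a₁ c γ Pr : ℝ) (X : ℂ) :
    P k a₁ c γ Pr X = X ^ 3 + (2 * I * k * a₁ * (1 + 3 * γ / (4 * Pr))) * X ^ 2
      + (-((c : ℂ) ^ 2 + (3 * γ / Pr) * a₁ ^ 2 * k ^ 2)) * X
      + (-((3 * I * k * a₁ * c ^ 2) / (2 * Pr))) := by
  unfold P; ring

/-- The branch of roots of `P` emanating from `-i k a₁ + t`, where `t² = c²/γ - k² a₁²`. -/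
theorem exists_bounded_branch {k a₁ c γ : ℝ} (hk : k ≠ 0) (ha : a₁ ≠ 0) (hγ : γ ≠ 0)
    {t : ℂ} (ht0 : t ≠ 0) (ht : t ^ 2 = (c : ℂ) ^ 2 / γ - k ^ 2 * a₁ ^ 2) :
    ∃ ξ : ℝ → ℂ, (∀ Pr : ℝ, P k a₁ c γ Pr (ξ Pr) = 0) ∧
      (fun Pr : ℝ => ξ Pr - (-(I * k * a₁) + t
          - ((γ - 1) * c ^ 2 * (k * a₁ + I * t) / (3 * γ ^ 2 * k * a₁ * t)) * Pr))
        =O[nhdsWithin 0 (Set.Ioi 0)] (fun Pr : ℝ => Pr ^ 2) := by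
  have hk' : (k : ℂ) ≠ 0 := by exact_mod_cast hk
  have ha' : (a₁ : ℂ) ≠ 0 := by exact_mod_cast ha
  have hγ' : (γ : ℂ) ≠ 0 := by exact_mod_cast hγ
  have hc2 : (c : ℂ) ^ 2 = γ * (t ^ 2 + k ^ 2 * a₁ ^ 2) := by
    rw [ht]; field_simp; ring
  set X₀ : ℂ := -(I * k * a₁) + t with hX₀
  set X₁ : ℂ := (γ - 1) * c ^ 2 * (k * a₁ + I * t) / (3 * γ ^ 2 * k * a₁ * t) with hX₁
  have hfirst : 3 * I * γ * k * a₁ * t * X₁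
      = X₀ ^ 3 + 2 * I * k * a₁ * X₀ ^ 2 - c ^ 2 * X₀ := by
    have : 3 * γ * k * a₁ * t * X₁ = (γ - 1) * (t ^ 2 + k ^ 2 * a₁ ^ 2) * (k * a₁ + I * t) := by
      rw [hX₁, hc2]; field_simp
    rw [hX₀, hc2]
    linear_combination I * this
      + (γ * t ^ 3 - t ^ 3 + γ * k ^ 2 * a₁ ^ 2 * t - I * k ^ 3 * a₁ ^ 3) * I_sq
  clear_value X₀ X₁
  choose ξ hroot hle using fun Pr : ℝ => exists_cubic_root_norm_sub_mul_le
    (2 * I * k * a₁ * (1 + 3 * γ / (4 * Pr))) (-((c : ℂ) ^ 2 + (3 * γ / Pr) * a₁ ^ 2 * k ^ 2))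
    (-((3 * I * k * a₁ * c ^ 2) / (2 * Pr))) (X₀ - X₁ * Pr)
  refine ⟨ξ, fun Pr => by rw [P_eq]; exact hroot Pr, ?_⟩
  set D : ℝ → ℂ := fun p => 3 * I * γ * k * a₁ * (t - X₁ * p)
    + p * (3 * (X₀ - X₁ * p) ^ 2 + 4 * I * k * a₁ * (X₀ - X₁ * p) - c ^ 2) with hD
  set R : ℝ → ℂ := fun p => 3 / 2 * I * γ * k * a₁ * X₁ ^ 2
    - X₁ * (3 * X₀ ^ 2 + 4 * I * k * a₁ * X₀ - c ^ 2)
    + p * X₁ ^ 2 * (3 * X₀ + 2 * I * k * a₁) - p ^ 2 * X₁ ^ 3 with hR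
  have hDc : Continuous D := by fun_prop
  have hRc : Continuous R := by fun_prop
  have hD0 : D 0 ≠ 0 := by simp [hD, hk, ha, hγ, ht0]
  have hquot : (fun p => R p / D p) =O[nhds (0 : ℝ)] (fun _ => (1 : ℝ)) :=
    (hRc.continuousAt.div hDc.continuousAt hD0).isBigO_one ℝ
  have hbound : (fun p : ℝ => ξ p - (X₀ - X₁ * p))
      =O[nhdsWithin 0 (Set.Ioi 0)] (fun p : ℝ => (p : ℂ) ^ 2 * (R p / D p)) := by
    refine IsBigO.of_bound 3 ?_
    filter_upwards [self_mem_nhdsWithin,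
      nhdsWithin_le_nhds (hDc.continuousAt.eventually_ne hD0)] with p hp hDp
    have hp' : 0 < p := hp
    have hpC : (p : ℂ) ≠ 0 := by exact_mod_cast hp'.ne'
    have h := hle p
    have hder : 3 * (X₀ - X₁ * p) ^ 2
        + 2 * (2 * I * k * a₁ * (1 + 3 * γ / (4 * p))) * (X₀ - X₁ * p)
        + -((c : ℂ) ^ 2 + (3 * γ / p) * a₁ ^ 2 * k ^ 2) = D p / p := by
      simp only [hD]
      field_simp
      linear_combination 12 * I * γ * k * a₁ * hX₀ - 12 * γ * k ^ 2 * a₁ ^ 2 * I_sq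
    have hval : (X₀ - X₁ * p) ^ 3
        + (2 * I * k * a₁ * (1 + 3 * γ / (4 * p))) * (X₀ - X₁ * p) ^ 2
        + -((c : ℂ) ^ 2 + (3 * γ / p) * a₁ ^ 2 * k ^ 2) * (X₀ - X₁ * p)
        + -((3 * I * k * a₁ * c ^ 2) / (2 * p)) = p * R p := by
      simp only [hR]
      field_simp
      linear_combination 8 * (-p * hfirst - 3 / 2 * I * k * a₁ * hc2
        + (3 / 2 * I * γ * k * a₁ * (X₀ + I * k * a₁ + t) - 3 * I * γ * k * a₁ * X₁ * p) * hX₀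
        + (3 * γ * k ^ 2 * a₁ ^ 2 * X₁ * p - 3 / 2 * I * γ * k ^ 3 * a₁ ^ 3
          - 3 * γ * k ^ 2 * a₁ ^ 2 * X₀) * I_sq)
    rw [hder, hval, norm_div, norm_mul, Complex.norm_real, Real.norm_of_nonneg hp'.le] at h
    have hDn : 0 < ‖D p‖ := norm_pos_iff.2 hDp
    rw [norm_sub_rev, norm_mul, norm_div, norm_pow, Complex.norm_real,
      Real.norm_of_nonneg hp'.le]
    rw [mul_div_assoc', div_le_iff₀ hp'] at h
    rw [mul_div_assoc', mul_div_assoc', le_div_iff₀ hDn]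
    linarith
  have hsq : (fun p : ℝ => (p : ℂ) ^ 2) =O[nhdsWithin 0 (Set.Ioi 0)] (fun p : ℝ => p ^ 2) :=
    IsBigO.of_bound 1 (by simp)
  simpa using hbound.trans (hsq.mul
    (hquot.mono nhdsWithin_le_nhds))

/-- Assume 0 < k a₁ < c/√γ. There exist ε > 0 and functions
ξ⁻, ξ⁰, ξ⁺ : (0, ε) → ℂ which are roots of P_Pr such that, as Pr → 0⁺,
ξ^∓(Pr) = −i k a₁ ∓ c_T(k) ± ((γ−1) c² (k a₁ ∓ i c_T(k)) / (3 γ² k a₁ c_T(k))) · Pr + O(Pr²)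
and ξ⁰(Pr) = −(3 i k a₁ γ)/(2 Pr) + O(Pr). -/
theorem stmt_6 (ρ μ c k γ : ℝ) (hρ : 0 < ρ) (hμ : 0 < μ) (hc : 0 < c) (hk : 0 < k)
    (hγ : 1 < γ) (a₁ : ℝ) (ha₁ : a₁ = 2 * μ / (3 * ρ))
    (hka : 0 < k * a₁) (hlt : k * a₁ < c / Real.sqrt γ)
    (cT : ℝ) (hcT : cT = Real.sqrt (c ^ 2 / γ - k ^ 2 * a₁ ^ 2)) :
    ∃ ε : ℝ, 0 < ε ∧ ∃ ξm ξ0 ξp : ℝ → ℂ,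
      (∀ Pr : ℝ, Pr ∈ Set.Ioo 0 ε →
        P k a₁ c γ Pr (ξm Pr) = 0 ∧ P k a₁ c γ Pr (ξ0 Pr) = 0 ∧ P k a₁ c γ Pr (ξp Pr) = 0)
      ∧ (fun Pr : ℝ => ξm Pr -
            (-(I * (k : ℂ) * (a₁ : ℂ)) - (cT : ℂ)
              + (((γ : ℂ) - 1) * (c : ℂ) ^ 2 * ((k : ℂ) * (a₁ : ℂ) - I * (cT : ℂ))
                  / (3 * (γ : ℂ) ^ 2 * (k : ℂ) * (a₁ : ℂ) * (cT : ℂ))) * (Pr : ℂ)))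
          =O[nhdsWithin 0 (Set.Ioi 0)] (fun Pr : ℝ => Pr ^ 2)
      ∧ (fun Pr : ℝ => ξp Pr -
            (-(I * (k : ℂ) * (a₁ : ℂ)) + (cT : ℂ)
              - (((γ : ℂ) - 1) * (c : ℂ) ^ 2 * ((k : ℂ) * (a₁ : ℂ) + I * (cT : ℂ))
                  / (3 * (γ : ℂ) ^ 2 * (k : ℂ) * (a₁ : ℂ) * (cT : ℂ))) * (Pr : ℂ)))
          =O[nhdsWithin 0 (Set.Ioi 0)] (fun Pr : ℝ => Pr ^ 2)
      ∧ (fun Pr : ℝ => ξ0 Pr - (-(3 * I * (k : ℂ) * (a₁ : ℂ) * (γ : ℂ)) / (2 * (Pr : ℂ))))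
          =O[nhdsWithin 0 (Set.Ioi 0)] (fun Pr : ℝ => Pr) := by
  have hγ0 : 0 < γ := by linarith
  have ha : a₁ ≠ 0 := by rintro rfl; simp at hka
  have hpos : 0 < c ^ 2 / γ - k ^ 2 * a₁ ^ 2 := by
    have h := pow_lt_pow_left₀ hlt hka.le two_ne_zero
    rw [div_pow, Real.sq_sqrt hγ0.le, mul_pow] at h
    linarith
  have hcT0 : (cT : ℂ) ≠ 0 := by
    rw [hcT]; exact_mod_cast (Real.sqrt_pos.2 hpos).ne'
  have hsq : (cT : ℂ) ^ 2 = (c : ℂ) ^ 2 / γ - k ^ 2 * a₁ ^ 2 := by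
    have : cT ^ 2 = c ^ 2 / γ - k ^ 2 * a₁ ^ 2 := by rw [hcT, Real.sq_sqrt hpos.le]
    exact_mod_cast this
  obtain ⟨ξp, hξp, hOp⟩ := exists_bounded_branch hk.ne' ha hγ0.ne' hcT0 hsq
  obtain ⟨ξm, hξm, hOm⟩ := exists_bounded_branch hk.ne' ha hγ0.ne' (neg_ne_zero.2 hcT0)
    (by rw [neg_sq]; exact hsq)
  have hp1 : (fun p : ℝ => ξp p - (-(I * k * a₁) + cT)) =O[nhdsWithin 0 (Set.Ioi 0)]
      (fun p : ℝ => p) :=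
    isBigO_sub_const_of_expansion hOp
  have hm1 : (fun p : ℝ => ξm p - (-(I * k * a₁) + -cT)) =O[nhdsWithin 0 (Set.Ioi 0)]
      (fun p : ℝ => p) :=
    isBigO_sub_const_of_expansion hOm
  have hne : ∀ᶠ p : ℝ in nhdsWithin 0 (Set.Ioi 0), ξp p ≠ ξm p := by
    have hid : Tendsto (fun p : ℝ => p) (nhdsWithin 0 (Set.Ioi 0)) (nhds 0) :=
      tendsto_id.mono_left nhdsWithin_le_nhds
    have hlim := (hp1.sub hm1).trans_tendsto hid
    filter_upwards [hlim.eventually_ne (b₂ := -(2 * (cT : ℂ))) (by simpa using hcT0)] with p hp h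
    apply hp
    rw [h]; ring
  obtain ⟨ε, hε, hne⟩ := mem_nhdsGT_iff_exists_Ioo_subset.1 hne
  refine ⟨ε, hε, ξm, fun p => -(2 * I * k * a₁ * (1 + 3 * γ / (4 * p))) - ξp p - ξm p, ξp,
    fun p hp => ⟨hξm p, ?_, hξp p⟩, ?_, ?_, ?_⟩
  · have h1 := hξp p
    have h2 := hξm p
    rw [P_eq] at h1 h2 ⊢
    exact cubic_eq_zero_of_two_roots (hne hp) h1 h2
  · refine hOm.congr_left fun p => ?_
    rw [mul_neg, mul_neg, div_neg]
    ring
  · exact hOp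
  · refine (hp1.add hm1).neg_left.congr_left fun p => ?_
    have : 3 * (γ : ℂ) / (4 * p) = 3 * γ / (2 * p) / 2 := by rw [div_div]; ring
    simp only [this]
    ring
end
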